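/- Let ℓ ≥ 2 and i ∈ {1,2} be integers with k = 3ℓ + i and k ≠ 8. Let G be a finite simple graph and let G' be the graph obtained from G by replacing every edge {u,v} of G by two internally disjoint paths from u to v, one of length ℓ and one of length ℓ+1, using distinct new internal vertices for distinct edges. Then the number of subgraphs of G' isomorphic to the cycle C_k equals 3 times the number of triangles of G. -/

import Mathlib

/-- An (arbitrarily chosen) ordered pair of the two endpoints of an edge. -/
noncomputable def Sym2.ends {V : Type*} (e : Sym2 V) : V × V := Quot.out e

/-- The graph obtained from `G` by replacing every edge `{u,v}` of `G` by two
internally disjoint paths from `u` to `v`, one of length `ℓ` (through the `ℓ - 1`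
new internal vertices `(e, i)` for `i : Fin (ℓ - 1)`) and one of length `ℓ + 1`
(through the `ℓ` further new internal vertices `(e, i)` for `i : Fin ℓ`), with
distinct new internal vertices for distinct edges. -/
noncomputable def SimpleGraph.doublePathSubdivision {V : Type*} (G : SimpleGraph V) (ℓ : ℕ) :
    SimpleGraph (V ⊕ ((G.edgeSet × Fin (ℓ - 1)) ⊕ (G.edgeSet × Fin ℓ))) :=
  SimpleGraph.fromRel fun x y =>
    match x, y with
    | Sum.inl u, Sum.inr (Sum.inl (e, i)) =>
        (u = (Sym2.ends e.1).1 ∧ (i : ℕ) = 0) ∨ (u = (Sym2.ends e.1).2 ∧ (i : ℕ) = ℓ - 2)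
    | Sum.inl u, Sum.inr (Sum.inr (e, i)) =>
        (u = (Sym2.ends e.1).1 ∧ (i : ℕ) = 0) ∨ (u = (Sym2.ends e.1).2 ∧ (i : ℕ) = ℓ - 1)
    | Sum.inr (Sum.inl (e, i)), Sum.inr (Sum.inl (e', j)) => e = e' ∧ (j : ℕ) = (i : ℕ) + 1
    | Sum.inr (Sum.inr (e, i)), Sum.inr (Sum.inr (e', j)) => e = e' ∧ (j : ℕ) = (i : ℕ) + 1
    | _, _ => False

namespace SimpleGraph

section CycleCriterion

variable {α : Type*} {H : SimpleGraph α}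

theorem ncard_neighborSet_cycleGraph {k : ℕ} (hk : 3 ≤ k) (v : Fin k) :
    ((cycleGraph k).neighborSet v).ncard = 2 := by
  obtain ⟨n, rfl⟩ : ∃ n, k = n + 3 := ⟨k - 3, by omega⟩
  rw [← cycleGraph_degree_three_le (v := v), ← card_neighborSet_eq_degree,
    Set.ncard_eq_toFinset_card', Set.toFinset_card]

theorem Iso.ncard_neighborSet_eq {β : Type*} {K : SimpleGraph β} (φ : H ≃g K) (x : α) :
    (H.neighborSet x).ncard = (K.neighborSet (φ x)).ncard :=
  Nat.card_congr (φ.mapNeighborSet x)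

theorem nonempty_iso_cycleGraph [Finite α] (hH : H.Connected)
    (hdeg : ∀ x, (H.neighborSet x).ncard = 2) :
    Nonempty (H ≃g cycleGraph (Nat.card α)) := by
  obtain ⟨v⟩ := hH.nonempty
  have hcyc : H.IsCycles := fun x _ => hdeg x
  have hne : (H.neighborSet v).Nonempty := by
    rw [← Set.ncard_pos]
    simp [hdeg]
  obtain ⟨p, hp, hpv⟩ := hcyc.exists_cycle_toSubgraph_verts_eq_connectedComponentSupp
    (c := H.connectedComponentMk v) rfl hne
  have hsupp : ∀ x, x ∈ p.support := by
    intro x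
    rw [← Walk.mem_verts_toSubgraph, hpv]
    exact ConnectedComponent.sound (hH.preconnected x v)
  have hlen : p.length = Nat.card α := by
    classical
    have := Fintype.ofFinite α
    have hham : p.IsHamiltonianCycle := by
      rw [Walk.isHamiltonianCycle_iff_isCycle_and_support_count_tail_eq_one]
      refine ⟨hp, fun a => List.count_eq_one_of_mem hp.support_nodup ?_⟩
      have := hsupp a
      rw [← Walk.cons_tail_support, List.mem_cons] at this
      rcases this with rfl | h
      · exact Walk.end_mem_tail_support hp.not_nil
      · exact h
    rw [hham.length_eq, Nat.card_eq_fintype_card]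
  have h3 := hp.three_le_length
  obtain ⟨f⟩ := (cycleGraph_isContained_iff (G := H) (n := Nat.card α) (by omega)).2
    ⟨v, p, hp, hlen⟩
  have hbij : Function.Bijective f :=
    (Nat.bijective_iff_injective_and_card f).2 ⟨f.injective, by simp⟩
  refine ⟨RelIso.symm ⟨Equiv.ofBijective f hbij, ?_⟩⟩
  intro a b
  refine ⟨fun hab => ?_, fun hab => f.toHom.map_adj hab⟩
  have himage : f '' ((cycleGraph (Nat.card α)).neighborSet a) = H.neighborSet (f a) := by
    refine Set.eq_of_subset_of_ncard_le ?_ ?_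
    · rintro _ ⟨c, hc, rfl⟩
      exact f.toHom.map_adj hc
    · rw [hdeg, Set.ncard_image_of_injective (f := ⇑f) _ f.injective,
        ncard_neighborSet_cycleGraph (by omega)]
  have hmem : f b ∈ f '' ((cycleGraph (Nat.card α)).neighborSet a) := himage ▸ hab
  obtain ⟨c, hc, hcb⟩ := hmem
  exact f.injective hcb ▸ hc

theorem Subgraph.ncard_coe_neighborSet (S : H.Subgraph) (x : S.verts) :
    (S.coe.neighborSet x).ncard = (S.neighborSet x).ncard :=
  Nat.card_congr (S.coeNeighborSetEquiv x)

theorem Subgraph.connected_of_forall_pred {S : H.Subgraph} {a : α} (ha : a ∈ S.verts)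
    (h : ∀ Q : α → Prop, Q a → (∀ x y, S.Adj x y → Q x → Q y) → ∀ x ∈ S.verts, Q x) :
    S.coe.Connected := by
  have hreach := h (fun x => ∀ hx : x ∈ S.verts, S.coe.Reachable ⟨a, ha⟩ ⟨x, hx⟩)
    (fun _ => Reachable.refl _)
    (fun x y hxy hQ _ => (hQ hxy.fst_mem).trans (Adj.reachable (G := S.coe) hxy))
  rw [connected_iff_exists_forall_reachable]
  exact ⟨⟨a, ha⟩, fun x => hreach x x.2 x.2⟩

theorem Subgraph.nonempty_iso_cycleGraph_of_connected [Finite α] {S : H.Subgraph}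
    (hS : S.coe.Connected) {k : ℕ} (hk : S.verts.ncard = k)
    (hdeg : ∀ x ∈ S.verts, (S.neighborSet x).ncard = 2) : Nonempty (S.coe ≃g cycleGraph k) := by
  subst hk
  exact nonempty_iso_cycleGraph hS fun x => by rw [ncard_coe_neighborSet, hdeg x x.2]

theorem Subgraph.ncard_verts_of_iso_cycleGraph {S : H.Subgraph} {k : ℕ}
    (φ : S.coe ≃g cycleGraph k) : S.verts.ncard = k := by
  simpa using Nat.card_congr φ.toEquiv

theorem Subgraph.ncard_neighborSet_of_iso_cycleGraph {S : H.Subgraph} {k : ℕ} (hk : 3 ≤ k)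
    (φ : S.coe ≃g cycleGraph k) {x : α} (hx : x ∈ S.verts) : (S.neighborSet x).ncard = 2 := by
  rw [← S.ncard_coe_neighborSet ⟨x, hx⟩, φ.ncard_neighborSet_eq, ncard_neighborSet_cycleGraph hk]

end CycleCriterion

namespace DoublePath

variable {V : Type*} {G : SimpleGraph V} {ℓ : ℕ}

/-- The vertices of the graph in which every edge is replaced by two paths. -/
abbrev Vertex (G : SimpleGraph V) (ℓ : ℕ) : Type _ :=
  V ⊕ ((G.edgeSet × Fin (ℓ - 1)) ⊕ (G.edgeSet × Fin ℓ))

/-- The length of the short (`false`) or long (`true`) path replacing an edge. -/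
def pathLength (ℓ : ℕ) (b : Bool) : ℕ := ℓ + b.toNat

/-- The first of the two chosen endpoints of an edge. -/
noncomputable def source (e : G.edgeSet) : V := (Sym2.ends e.1).1

/-- The second of the two chosen endpoints of an edge. -/
noncomputable def target (e : G.edgeSet) : V := (Sym2.ends e.1).2

/-- The `t`-th vertex of the short (`false`) or long (`true`) path replacing `e`. -/
noncomputable def pathVertex (e : G.edgeSet) : Bool → ℕ → Vertex G ℓ
  | _, 0 => Sum.inl (source e)
  | false, t + 1 => if h : t < ℓ - 1 then Sum.inr (Sum.inl (e, ⟨t, h⟩)) else Sum.inl (target e)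
  | true, t + 1 => if h : t < ℓ then Sum.inr (Sum.inr (e, ⟨t, h⟩)) else Sum.inl (target e)

theorem mk_source_target (e : G.edgeSet) : s(source e, target e) = e.1 :=
  Quot.out_eq e.1

theorem source_ne_target (e : G.edgeSet) : source e ≠ target e := by
  have h := e.2
  rw [← mk_source_target e, mem_edgeSet] at h
  exact h.ne

theorem mem_edge_iff (e : G.edgeSet) (v : V) : v ∈ e.1 ↔ v = source e ∨ v = target e := by
  conv_lhs => rw [← mk_source_target e]
  exact Sym2.mem_iff

theorem pathVertex_zero (e : G.edgeSet) (b : Bool) :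
    pathVertex (ℓ := ℓ) e b 0 = Sum.inl (source e) := by
  cases b <;> rfl

theorem pathVertex_pathLength (hℓ : 2 ≤ ℓ) (e : G.edgeSet) (b : Bool) :
    pathVertex (ℓ := ℓ) e b (pathLength ℓ b) = Sum.inl (target e) := by
  obtain ⟨n, rfl⟩ : ∃ n, ℓ = n + 2 := ⟨ℓ - 2, by omega⟩
  cases b <;> simp [pathVertex, pathLength]

theorem pathVertex_inj {e e' : G.edgeSet} {b b' : Bool} {t t' : ℕ} (ht : 0 < t)
    (htb : t < pathLength ℓ b) (ht' : 0 < t') (htb' : t' < pathLength ℓ b')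
    (h : pathVertex (ℓ := ℓ) e b t = pathVertex e' b' t') : e = e' ∧ b = b' ∧ t = t' := by
  obtain ⟨s, rfl⟩ : ∃ s, t = s + 1 := ⟨t - 1, by omega⟩
  obtain ⟨s', rfl⟩ : ∃ s, t' = s + 1 := ⟨t' - 1, by omega⟩
  cases b <;> cases b' <;> simp only [pathLength, Bool.toNat_false, Bool.toNat_true] at htb htb' <;>
    simp only [pathVertex] at h <;> rw [dif_pos (by omega), dif_pos (by omega)] at h <;>
    simp at h
  all_goals simp [h]

theorem pathVertex_ne_inl {e : G.edgeSet} {b : Bool} {t : ℕ} (ht : 0 < t)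
    (htb : t < pathLength ℓ b) (v : V) : pathVertex (ℓ := ℓ) e b t ≠ Sum.inl v := by
  obtain ⟨s, rfl⟩ : ∃ s, t = s + 1 := ⟨t - 1, by omega⟩
  cases b <;> simp only [pathLength, Bool.toNat_false, Bool.toNat_true] at htb <;>
    simp only [pathVertex] <;> rw [dif_pos (by omega)] <;> simp

theorem exists_eq_inl_or_pathVertex (x : Vertex G ℓ) : (∃ v, x = Sum.inl v) ∨
    ∃ e b t, 0 < t ∧ t < pathLength ℓ b ∧ x = pathVertex e b t := by
  rcases x with v | ⟨e, j⟩ | ⟨e, j⟩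
  · exact Or.inl ⟨v, rfl⟩
  · exact Or.inr ⟨e, false, j + 1, by omega, by simp [pathLength]; omega, by simp [pathVertex]⟩
  · exact Or.inr ⟨e, true, j + 1, by omega, by simp [pathLength], by simp [pathVertex]⟩

theorem adj_pathVertex_iff (hℓ : 2 ≤ ℓ) {e : G.edgeSet} {b : Bool} {t : ℕ} (ht : 0 < t)
    (htb : t < pathLength ℓ b) (x : Vertex G ℓ) :
    (G.doublePathSubdivision ℓ).Adj (pathVertex e b t) x ↔
      x = pathVertex e b (t - 1) ∨ x = pathVertex e b (t + 1) := by
  obtain ⟨s, rfl⟩ : ∃ s, t = s + 1 := ⟨t - 1, by omega⟩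
  rw [doublePathSubdivision, fromRel_adj]
  cases b <;> simp only [pathLength, Bool.toNat_false, Bool.toNat_true] at htb <;>
    rw [pathVertex, dif_pos (by omega)] <;> rcases s with _ | s <;>
    rcases x with v | ⟨e', j, hj⟩ | ⟨e', j, hj⟩ <;>
    simp [pathVertex, source, target] <;> split_ifs <;> simp [Prod.ext_iff] <;> grind

/-- The neighbour of `v` on the short (`false`) or long (`true`) path replacing `e`. -/
noncomputable def neighborOn (v : V) (e : G.edgeSet) (b : Bool) : Vertex G ℓ :=
  open Classical in
  if v = source e then pathVertex e b 1 else pathVertex e b (pathLength ℓ b - 1)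

theorem adj_inl_iff (hℓ : 2 ≤ ℓ) (v : V) (x : Vertex G ℓ) :
    (G.doublePathSubdivision ℓ).Adj (Sum.inl v) x ↔
      ∃ e b, v ∈ e.1 ∧ x = neighborOn v e b := by
  obtain ⟨n, rfl⟩ : ∃ n, ℓ = n + 2 := ⟨ℓ - 2, by omega⟩
  have hst := source_ne_target (G := G)
  simp only [mem_edge_iff]
  rw [doublePathSubdivision, fromRel_adj]
  rcases x with w | ⟨e', j, hj⟩ | ⟨e', j, hj⟩ <;>
    simp [neighborOn, pathVertex, pathLength, source, target, Bool.exists_bool] at hst ⊢ <;> grind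

theorem two_le_pathLength (hℓ : 2 ≤ ℓ) (b : Bool) : 2 ≤ pathLength ℓ b :=
  hℓ.trans (Nat.le_add_right _ _)

theorem exists_neighborOn_eq_pathVertex (hℓ : 2 ≤ ℓ) (v : V) (e : G.edgeSet) (b : Bool) :
    ∃ t, 0 < t ∧ t < pathLength ℓ b ∧ neighborOn (ℓ := ℓ) v e b = pathVertex e b t := by
  have := two_le_pathLength hℓ b
  unfold neighborOn
  split_ifs
  · exact ⟨1, by omega, by omega, rfl⟩
  · exact ⟨_, by omega, by omega, rfl⟩

theorem neighborOn_inj (hℓ : 2 ≤ ℓ) {v : V} {p q : G.edgeSet × Bool}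
    (h : neighborOn (ℓ := ℓ) v p.1 p.2 = neighborOn v q.1 q.2) : p = q := by
  obtain ⟨t, ht, htb, hp⟩ := exists_neighborOn_eq_pathVertex hℓ v p.1 p.2
  obtain ⟨s, hs, hsb, hq⟩ := exists_neighborOn_eq_pathVertex hℓ v q.1 q.2
  rw [hp, hq] at h
  obtain ⟨h1, h2, -⟩ := pathVertex_inj ht htb hs hsb h
  exact Prod.ext h1 h2

theorem pathVertex_pred_ne_succ (hℓ : 2 ≤ ℓ) {e : G.edgeSet} {b : Bool} {t : ℕ} (ht : 0 < t)
    (htb : t < pathLength ℓ b) :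
    pathVertex (ℓ := ℓ) e b (t - 1) ≠ pathVertex e b (t + 1) := by
  intro h
  rcases Nat.eq_or_lt_of_le (show 1 ≤ t from ht) with rfl | h1
  · rw [pathVertex_zero] at h
    rcases Nat.eq_or_lt_of_le (show 1 + 1 ≤ pathLength ℓ b from htb) with h2 | h2
    · rw [h2, pathVertex_pathLength hℓ] at h
      exact source_ne_target e (Sum.inl_injective h)
    · exact pathVertex_ne_inl (by omega) h2 _ h.symm
  · rcases Nat.eq_or_lt_of_le (show t + 1 ≤ pathLength ℓ b from htb) with h2 | h2
    · rw [h2, pathVertex_pathLength hℓ] at h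
      exact pathVertex_ne_inl (by omega) (by omega) _ h
    · have := (pathVertex_inj (by omega) (by omega) (by omega) h2 h).2.2
      omega

/-- A property of the vertices that is transferred between consecutive vertices of a path
holds on the whole path as soon as it holds somewhere. -/
theorem forall_of_consecutive {n : ℕ} {Q : ℕ → Prop}
    (h : ∀ t < n, Q t ↔ Q (t + 1)) {s t : ℕ} (hs : s ≤ n) (ht : t ≤ n) (hQ : Q s) : Q t := by
  have key : ∀ r ≤ n, Q 0 ↔ Q r := by
    intro r hr
    induction r with
    | zero => rfl
    | succ r ih => rw [ih (by omega), h r (by omega)]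
  exact (key t ht).1 ((key s hs).2 hQ)

/-- The branch vertices in `W` together with the inner vertices of the paths in `F`. -/
def unionVerts (W : Finset V) (F : Finset (G.edgeSet × Bool)) : Set (Vertex G ℓ) :=
  {x | (∃ v ∈ W, x = Sum.inl v) ∨
    ∃ p ∈ F, ∃ t, 0 < t ∧ t < pathLength ℓ p.2 ∧ x = pathVertex p.1 p.2 t}

theorem inl_mem_unionVerts {W : Finset V} {F : Finset (G.edgeSet × Bool)} {v : V} :
    Sum.inl v ∈ unionVerts (ℓ := ℓ) W F ↔ v ∈ W := by
  constructor
  · rintro (⟨w, hw, h⟩ | ⟨p, -, t, ht, htb, h⟩)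
    · rwa [Sum.inl_injective h]
    · exact (pathVertex_ne_inl ht htb v h.symm).elim
  · exact fun h => Or.inl ⟨v, h, rfl⟩

theorem pathVertex_mem_unionVerts {W : Finset V} {F : Finset (G.edgeSet × Bool)}
    {e : G.edgeSet} {b : Bool} {t : ℕ} (ht : 0 < t) (htb : t < pathLength ℓ b) :
    pathVertex e b t ∈ unionVerts (ℓ := ℓ) W F ↔ (e, b) ∈ F := by
  constructor
  · rintro (⟨w, -, h⟩ | ⟨p, hp, s, hs, hsb, h⟩)
    · exact (pathVertex_ne_inl ht htb w h).elim
    · obtain ⟨rfl, rfl, -⟩ := pathVertex_inj ht htb hs hsb h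
      exact hp
  · exact fun h => Or.inr ⟨(e, b), h, t, ht, htb, rfl⟩

theorem ncard_unionVerts (W : Finset V) (F : Finset (G.edgeSet × Bool)) :
    (unionVerts (ℓ := ℓ) W F).ncard = W.card + ∑ p ∈ F, (pathLength ℓ p.2 - 1) := by
  classical
  let A : Finset (Vertex G ℓ) := W.image Sum.inl
  let I : Finset (Σ _ : G.edgeSet × Bool, ℕ) := F.sigma fun p => Finset.Ioo 0 (pathLength ℓ p.2)
  let B : Finset (Vertex G ℓ) := I.image fun q => pathVertex q.1.1 q.1.2 q.2
  have hunion : unionVerts (ℓ := ℓ) W F = ↑(A ∪ B) := by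
    ext x
    simp only [unionVerts, A, B, I, Set.mem_ofPred_eq, Finset.mem_coe, Finset.mem_union,
      Finset.mem_image, Finset.mem_sigma, Finset.mem_Ioo, Sigma.exists, eq_comm (a := x),
      exists_and_left, and_assoc]
  have hdisj : Disjoint A B := by
    rw [Finset.disjoint_left]
    intro x hxA hxB
    obtain ⟨v, -, rfl⟩ := Finset.mem_image.1 hxA
    obtain ⟨q, hq, h⟩ := Finset.mem_image.1 hxB
    obtain ⟨-, hq⟩ := Finset.mem_sigma.1 hq
    obtain ⟨h0, h1⟩ := Finset.mem_Ioo.1 hq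
    exact pathVertex_ne_inl h0 h1 v h
  have hinj : Set.InjOn (fun q : Σ _ : G.edgeSet × Bool, ℕ =>
      pathVertex (ℓ := ℓ) q.1.1 q.1.2 q.2) I := by
    rintro ⟨⟨e, b⟩, t⟩ hq ⟨⟨e', b'⟩, t'⟩ hq' h
    simp only [I, Finset.coe_sigma, Set.mem_sigma_iff, Finset.mem_coe, Finset.mem_Ioo] at hq hq'
    obtain ⟨rfl, rfl, rfl⟩ := pathVertex_inj hq.2.1 hq.2.2 hq'.2.1 hq'.2.2 h
    rfl
  rw [hunion, Set.ncard_coe_finset, Finset.card_union_of_disjoint hdisj,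
    Finset.card_image_of_injective _ Sum.inl_injective, Finset.card_image_of_injOn hinj,
    Finset.card_sigma]
  simp

/-- The subgraph formed by the branch vertices in `W` and the paths in `F`. -/
noncomputable def unionSubgraph (ℓ : ℕ) (W : Finset V) (F : Finset (G.edgeSet × Bool)) :
    (G.doublePathSubdivision ℓ).Subgraph :=
  (⊤ : (G.doublePathSubdivision ℓ).Subgraph).induce (unionVerts W F)

theorem unionSubgraph_adj {W : Finset V} {F : Finset (G.edgeSet × Bool)} {x y : Vertex G ℓ} :
    (unionSubgraph ℓ W F).Adj x y ↔ x ∈ unionVerts W F ∧ y ∈ unionVerts W F ∧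
      (G.doublePathSubdivision ℓ).Adj x y := by
  simp [unionSubgraph]

open Classical in
theorem ncard_neighborSet_unionSubgraph_inl (hℓ : 2 ≤ ℓ) {W : Finset V}
    {F : Finset (G.edgeSet × Bool)} {v : V} (hv : v ∈ W) :
    ((unionSubgraph ℓ W F).neighborSet (Sum.inl v)).ncard = (F.filter (v ∈ ·.1.1)).card := by
  have : (unionSubgraph ℓ W F).neighborSet (Sum.inl v) =
      (fun p : G.edgeSet × Bool => neighborOn v p.1 p.2) '' (F.filter (v ∈ ·.1.1)) := by
    ext x
    simp only [Subgraph.mem_neighborSet, unionSubgraph_adj, inl_mem_unionVerts, hv, true_and,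
      adj_inl_iff hℓ, Set.mem_image, Finset.coe_filter, Set.mem_ofPred_eq, Prod.exists]
    constructor
    · rintro ⟨hx, e, b, hve, rfl⟩
      obtain ⟨t, ht, htb, h⟩ := exists_neighborOn_eq_pathVertex hℓ v e b
      rw [h, pathVertex_mem_unionVerts ht htb] at hx
      exact ⟨e, b, ⟨hx, hve⟩, rfl⟩
    · rintro ⟨e, b, ⟨hF, hve⟩, rfl⟩
      refine ⟨?_, e, b, hve, rfl⟩
      obtain ⟨t, ht, htb, h⟩ := exists_neighborOn_eq_pathVertex hℓ v e b
      rwa [h, pathVertex_mem_unionVerts ht htb]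
  rw [this, Set.ncard_image_of_injective _ fun p q h => neighborOn_inj hℓ h,
    Set.ncard_coe_finset]

theorem pathVertex_mem_unionVerts_of_le (hℓ : 2 ≤ ℓ) {W : Finset V}
    {F : Finset (G.edgeSet × Bool)} (hWF : ∀ p ∈ F, ∀ v ∈ p.1.1, v ∈ W)
    {p : G.edgeSet × Bool} (hp : p ∈ F) {t : ℕ} (ht : t ≤ pathLength ℓ p.2) :
    pathVertex p.1 p.2 t ∈ unionVerts (ℓ := ℓ) W F := by
  rcases Nat.eq_zero_or_pos t with rfl | h0
  · rw [pathVertex_zero, inl_mem_unionVerts]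
    exact hWF p hp _ ((mem_edge_iff _ _).2 (Or.inl rfl))
  rcases ht.eq_or_lt with rfl | h1
  · rw [pathVertex_pathLength hℓ, inl_mem_unionVerts]
    exact hWF p hp _ ((mem_edge_iff _ _).2 (Or.inr rfl))
  · exact (pathVertex_mem_unionVerts h0 h1).2 hp

theorem ncard_neighborSet_unionSubgraph_pathVertex (hℓ : 2 ≤ ℓ) {W : Finset V}
    {F : Finset (G.edgeSet × Bool)} (hWF : ∀ p ∈ F, ∀ v ∈ p.1.1, v ∈ W)
    {p : G.edgeSet × Bool} (hp : p ∈ F) {t : ℕ} (ht : 0 < t) (htb : t < pathLength ℓ p.2) :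
    ((unionSubgraph ℓ W F).neighborSet (pathVertex p.1 p.2 t)).ncard = 2 := by
  have : (unionSubgraph ℓ W F).neighborSet (pathVertex p.1 p.2 t) =
      {pathVertex p.1 p.2 (t - 1), pathVertex p.1 p.2 (t + 1)} := by
    ext x
    rw [Subgraph.mem_neighborSet, unionSubgraph_adj, adj_pathVertex_iff hℓ ht htb]
    simp only [Set.mem_insert_iff, Set.mem_singleton_iff]
    refine ⟨fun h => h.2.2, fun h =>
      ⟨pathVertex_mem_unionVerts_of_le hℓ hWF hp htb.le, ?_, h⟩⟩
    rcases h with rfl | rfl <;> exact pathVertex_mem_unionVerts_of_le hℓ hWF hp (by omega)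
  rw [this, Set.ncard_pair (pathVertex_pred_ne_succ hℓ ht htb)]

theorem pathVertex_adj_succ (hℓ : 2 ≤ ℓ) (e : G.edgeSet) (b : Bool) {t : ℕ}
    (ht : t < pathLength ℓ b) :
    (G.doublePathSubdivision ℓ).Adj (pathVertex e b t) (pathVertex e b (t + 1)) := by
  have := two_le_pathLength hℓ b
  rcases Nat.eq_zero_or_pos t with rfl | h0
  · exact ((adj_pathVertex_iff hℓ (b := b) one_pos (by omega) _).2 (Or.inl rfl)).symm
  · exact (adj_pathVertex_iff hℓ h0 ht _).2 (Or.inr rfl)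

/-- A subgraph all of whose vertices have degree two is a union of paths replacing edges. -/
theorem exists_eq_unionSubgraph [Finite V] (hℓ : 2 ≤ ℓ) {S : (G.doublePathSubdivision ℓ).Subgraph}
    (hS : ∀ x ∈ S.verts, (S.neighborSet x).ncard = 2) :
    ∃ (W : Finset V) (F : Finset (G.edgeSet × Bool)),
      (∀ p ∈ F, ∀ v ∈ p.1.1, v ∈ W) ∧ S = unionSubgraph ℓ W F := by
  classical
  have hadj : ∀ {e : G.edgeSet} {b : Bool} {t : ℕ} {x : Vertex G ℓ}, 0 < t →
      t < pathLength ℓ b → pathVertex e b t ∈ S.verts →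
      (G.doublePathSubdivision ℓ).Adj (pathVertex e b t) x → S.Adj (pathVertex e b t) x := by
    intro e b t x ht htb hmem hx
    have : S.neighborSet (pathVertex e b t) =
        {pathVertex e b (t - 1), pathVertex e b (t + 1)} := by
      refine Set.eq_of_subset_of_ncard_le ?_ ?_
      · intro y hy
        exact (adj_pathVertex_iff hℓ ht htb y).1 hy.adj_sub
      · rw [hS _ hmem]
        exact (Set.ncard_insert_le _ _).trans (by simp)
    change x ∈ S.neighborSet _
    rw [this]
    exact (adj_pathVertex_iff hℓ ht htb x).1 hx
  have hinner : ∀ {e : G.edgeSet} {b : Bool} {s t : ℕ}, 0 < s → s < pathLength ℓ b →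
      0 < t → t < pathLength ℓ b → pathVertex e b s ∈ S.verts → pathVertex e b t ∈ S.verts := by
    intro e b s t hs hsb ht htb h
    have := forall_of_consecutive (n := pathLength ℓ b - 2)
      (Q := fun r => pathVertex e b (r + 1) ∈ S.verts) (s := s - 1) (t := t - 1) ?_
      (by omega) (by omega) (by rwa [Nat.sub_add_cancel hs])
    · rwa [Nat.sub_add_cancel ht] at this
    · intro r hr
      have hr1 := pathVertex_adj_succ hℓ e b (t := r + 1) (by omega)
      exact ⟨fun h => (hadj (by omega) (by omega) h hr1).snd_mem,
        fun h => (hadj (by omega) (by omega) h hr1.symm).snd_mem⟩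
  have := Fintype.ofFinite V
  let W : Finset V := {v | Sum.inl v ∈ S.verts}
  let F : Finset (G.edgeSet × Bool) := {p | pathVertex p.1 p.2 1 ∈ S.verts}
  have hverts : S.verts = unionVerts W F := by
    ext x
    rcases exists_eq_inl_or_pathVertex x with ⟨v, rfl⟩ | ⟨e, b, t, ht, htb, rfl⟩
    · simp [inl_mem_unionVerts, W]
    · rw [pathVertex_mem_unionVerts ht htb]
      simp only [F, Finset.mem_filter, Finset.mem_univ, true_and]
      exact ⟨hinner ht htb (by omega) (by omega), hinner (by omega) (by omega) ht htb⟩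
  refine ⟨W, F, ?_, ?_⟩
  · intro p hp v hv
    have h2 := two_le_pathLength hℓ p.2
    have h1 : pathVertex p.1 p.2 1 ∈ S.verts := by simpa [F] using hp
    simp only [W, Finset.mem_filter, Finset.mem_univ, true_and]
    rcases (mem_edge_iff _ _).1 hv with rfl | rfl
    · rw [← pathVertex_zero p.1 p.2]
      exact (hadj (by omega) (by omega) h1
        (pathVertex_adj_succ hℓ p.1 p.2 (t := 0) (by omega)).symm).snd_mem
    · have hlast := hinner (t := pathLength ℓ p.2 - 1) (by omega) (by omega) (by omega)
        (by omega) h1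
      have h := hadj (by omega) (by omega) hlast
        (pathVertex_adj_succ hℓ p.1 p.2 (t := pathLength ℓ p.2 - 1) (by omega))
      rw [Nat.sub_add_cancel (by omega), pathVertex_pathLength hℓ] at h
      exact h.snd_mem
  · refine Subgraph.ext hverts ?_
    ext x y
    rw [unionSubgraph_adj, ← hverts]
    refine ⟨fun h => ⟨h.fst_mem, h.snd_mem, h.adj_sub⟩, ?_⟩
    rintro ⟨hx, hy, hxy⟩
    rcases exists_eq_inl_or_pathVertex x with ⟨v, rfl⟩ | ⟨e, b, t, ht, htb, rfl⟩
    · obtain ⟨e, b, -, rfl⟩ := (adj_inl_iff hℓ v y).1 hxy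
      obtain ⟨t, ht, htb, h⟩ := exists_neighborOn_eq_pathVertex hℓ v e b
      rw [h] at hy hxy ⊢
      exact (hadj ht htb hy hxy.symm).symm
    · exact hadj ht htb hx hxy

/-- A union of paths replacing edges is connected if its branch vertices are. -/
theorem unionSubgraph_connected (hℓ : 2 ≤ ℓ) {W : Finset V}
    {F : Finset (G.edgeSet × Bool)} (hWF : ∀ p ∈ F, ∀ v ∈ p.1.1, v ∈ W) {a : V} (ha : a ∈ W)
    (hconn : ∀ v ∈ W, v ≠ a → ∃ p ∈ F, p.1.1 = s(a, v)) :
    (unionSubgraph ℓ W F).coe.Connected := by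
  refine Subgraph.connected_of_forall_pred (a := Sum.inl a) (inl_mem_unionVerts.2 ha) ?_
  intro Q hQa hQ
  have hpath : ∀ p ∈ F, ∀ s ≤ pathLength ℓ p.2, ∀ t ≤ pathLength ℓ p.2,
      Q (pathVertex p.1 p.2 s) → Q (pathVertex p.1 p.2 t) := by
    intro p hp s hs t ht
    refine forall_of_consecutive (Q := fun r => Q (pathVertex p.1 p.2 r)) ?_ hs ht
    intro r hr
    have hadj : (unionSubgraph ℓ W F).Adj (pathVertex p.1 p.2 r) (pathVertex p.1 p.2 (r + 1)) :=
      unionSubgraph_adj.2 ⟨pathVertex_mem_unionVerts_of_le hℓ hWF hp hr.le,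
        pathVertex_mem_unionVerts_of_le hℓ hWF hp hr, pathVertex_adj_succ hℓ _ _ hr⟩
    exact ⟨hQ _ _ hadj, hQ _ _ hadj.symm⟩
  have hend : ∀ p ∈ F, ∀ v ∈ p.1.1, ∃ s ≤ pathLength ℓ p.2,
      pathVertex (ℓ := ℓ) p.1 p.2 s = Sum.inl v := by
    intro p hp v hv
    rcases (mem_edge_iff _ _).1 hv with rfl | rfl
    · exact ⟨0, Nat.zero_le _, pathVertex_zero _ _⟩
    · exact ⟨_, le_rfl, pathVertex_pathLength hℓ _ _⟩
  have hbranch : ∀ v ∈ W, Q (Sum.inl v) := by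
    intro v hv
    by_cases hva : v = a
    · rwa [hva]
    obtain ⟨p, hp, hpe⟩ := hconn v hv hva
    obtain ⟨s, hs, hsa⟩ := hend p hp a (by simp [hpe])
    obtain ⟨t, ht, htv⟩ := hend p hp v (by simp [hpe])
    rw [← htv]
    exact hpath p hp s hs t ht (hsa ▸ hQa)
  rintro x (⟨v, hv, rfl⟩ | ⟨p, hp, t, ht, htb, rfl⟩)
  · exact hbranch v hv
  · refine hpath p hp 0 (Nat.zero_le _) t htb.le ?_
    rw [pathVertex_zero]
    exact hbranch _ (hWF p hp _ ((mem_edge_iff _ _).2 (Or.inl rfl)))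

theorem unionSubgraph_inj (hℓ : 2 ≤ ℓ) {W W' : Finset V} {F F' : Finset (G.edgeSet × Bool)}
    (h : unionSubgraph ℓ W F = unionSubgraph ℓ W' F') : W = W' ∧ F = F' := by
  have hverts : unionVerts (ℓ := ℓ) W F = unionVerts W' F' := congrArg Subgraph.verts h
  constructor
  · ext v
    rw [← inl_mem_unionVerts (ℓ := ℓ) (F := F), hverts, inl_mem_unionVerts]
  · ext ⟨e, b⟩
    have := two_le_pathLength hℓ b
    rw [← pathVertex_mem_unionVerts (ℓ := ℓ) (W := W) one_pos (by omega), hverts,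
      pathVertex_mem_unionVerts one_pos (by omega)]

section Counting

open scoped Classical

theorem sum_pathLength (hℓ : 2 ≤ ℓ) (F : Finset (G.edgeSet × Bool)) :
    ∑ p ∈ F, (pathLength ℓ p.2 - 1) + F.card = F.card * ℓ + (F.filter (·.2 = true)).card := by
  rw [Finset.card_filter, ← smul_eq_mul, ← Finset.sum_const, ← Finset.sum_add_distrib,
    Finset.card_eq_sum_ones, ← Finset.sum_add_distrib]
  refine Finset.sum_congr rfl fun p _ => ?_
  rcases p with ⟨e, _ | _⟩ <;> simp [pathLength]
  omega

theorem card_eq_of_forall_card_filter_mem {W : Finset V} {F : Finset (G.edgeSet × Bool)}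
    (hWF : ∀ p ∈ F, ∀ v ∈ p.1.1, v ∈ W)
    (hdeg : ∀ v ∈ W, (F.filter (v ∈ ·.1.1)).card = 2) : W.card = F.card := by
  have hcount := Finset.sum_card_bipartiteAbove_eq_sum_card_bipartiteBelow
    (s := W) (t := F) (fun v p => v ∈ p.1.1)
  have h1 : ∑ v ∈ W, (F.bipartiteAbove (fun v p => v ∈ p.1.1) v).card = W.card * 2 := by
    rw [Finset.sum_const_nat]
    exact hdeg
  have h2 : ∑ p ∈ F, (W.bipartiteBelow (fun v p => v ∈ p.1.1) p).card = F.card * 2 := by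
    rw [Finset.sum_const_nat]
    intro p hp
    have : W.bipartiteBelow (fun v p => v ∈ p.1.1) p = {source p.1, target p.1} := by
      ext v
      rw [Finset.mem_bipartiteBelow, mem_edge_iff, Finset.mem_insert, Finset.mem_singleton]
      exact ⟨And.right, fun h => ⟨hWF p hp v ((mem_edge_iff _ _).2 h), h⟩⟩
    rw [this, Finset.card_pair (source_ne_target p.1)]
  omega

theorem card_filter_mem_of_forall_ncard (hℓ : 2 ≤ ℓ) {W : Finset V}
    {F : Finset (G.edgeSet × Bool)}
    (h : ∀ x ∈ (unionSubgraph ℓ W F).verts, ((unionSubgraph ℓ W F).neighborSet x).ncard = 2)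
    {v : V} (hv : v ∈ W) : (F.filter (v ∈ ·.1.1)).card = 2 := by
  rw [← ncard_neighborSet_unionSubgraph_inl hℓ hv]
  exact h _ (inl_mem_unionVerts.2 hv)

variable [Fintype V]

/-- The edges of `G` with both endpoints in `W`. -/
noncomputable def edgesIn (G : SimpleGraph V) (W : Finset V) : Finset G.edgeSet :=
  {e | ∀ v ∈ e.1, v ∈ W}

/-- One path for each edge inside `W`: the long one for edges in `L`, else the short one. -/
noncomputable def choosePaths (W : Finset V) (L : Finset G.edgeSet) :
    Finset (G.edgeSet × Bool) :=
  {p | p.1 ∈ edgesIn G W ∧ (p.2 = true ↔ p.1 ∈ L)}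

theorem mem_edgesIn {W : Finset V} {e : G.edgeSet} : e ∈ edgesIn G W ↔ ∀ v ∈ e.1, v ∈ W := by
  simp [edgesIn]

theorem mem_choosePaths {W : Finset V} {L : Finset G.edgeSet} {p : G.edgeSet × Bool} :
    p ∈ choosePaths W L ↔ p.1 ∈ edgesIn G W ∧ (p.2 = true ↔ p.1 ∈ L) := by
  simp [choosePaths]

theorem image_val_edgesIn_subset (W : Finset V) :
    (edgesIn G W).image Subtype.val ⊆ W.offDiag.image Sym2.mk.uncurry := by
  intro z hz
  obtain ⟨e, he, rfl⟩ := Finset.mem_image.1 hz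
  rw [mem_edgesIn] at he
  refine Finset.mem_image.2 ⟨(source e, target e), Finset.mem_offDiag.2 ⟨?_, ?_, ?_⟩,
    mk_source_target e⟩
  · exact he _ ((mem_edge_iff _ _).2 (Or.inl rfl))
  · exact he _ ((mem_edge_iff _ _).2 (Or.inr rfl))
  · exact source_ne_target e

theorem card_edgesIn_le (W : Finset V) : (edgesIn G W).card ≤ W.card.choose 2 := by
  rw [← Sym2.card_image_offDiag, ← Finset.card_image_of_injective _ Subtype.val_injective]
  exact Finset.card_le_card (image_val_edgesIn_subset W)

theorem isClique_of_card_edgesIn {W : Finset V} (h : W.card.choose 2 ≤ (edgesIn G W).card) :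
    G.IsClique W := by
  have himage := Finset.eq_of_subset_of_card_le (image_val_edgesIn_subset (G := G) W) (by
    rwa [Sym2.card_image_offDiag, Finset.card_image_of_injective _ Subtype.val_injective])
  intro v hv w hw hvw
  have hmem : s(v, w) ∈ (edgesIn G W).image Subtype.val := by
    rw [himage]
    exact Finset.mem_image.2 ⟨(v, w), Finset.mem_offDiag.2 ⟨hv, hw, hvw⟩, rfl⟩
  obtain ⟨e, -, he⟩ := Finset.mem_image.1 hmem
  rw [← mem_edgeSet, ← he]
  exact e.2

theorem card_edgesIn {W : Finset V} (hW : G.IsClique W) :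
    (edgesIn G W).card = W.card.choose 2 := by
  refine le_antisymm (card_edgesIn_le W) ?_
  rw [← Sym2.card_image_offDiag, ← Finset.card_image_of_injective (edgesIn G W)
    Subtype.val_injective]
  refine Finset.card_le_card fun z hz => ?_
  obtain ⟨⟨v, w⟩, hvw, rfl⟩ := Finset.mem_image.1 hz
  obtain ⟨hv, hw, hne⟩ := Finset.mem_offDiag.1 hvw
  refine Finset.mem_image.2 ⟨⟨s(v, w), hW hv hw hne⟩, mem_edgesIn.2 fun x hx => ?_, rfl⟩
  rcases Sym2.mem_iff.1 hx with rfl | rfl <;> assumption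

theorem card_filter_mem_edgesIn {W : Finset V} (hW : G.IsClique W) {v : V} (hv : v ∈ W) :
    ((edgesIn G W).filter (v ∈ ·.1)).card = W.card - 1 := by
  have himage : ((edgesIn G W).filter (v ∈ ·.1)).image Subtype.val =
      (W.erase v).image (s(v, ·)) := by
    ext z
    simp only [Finset.mem_image, Finset.mem_filter, mem_edgesIn, Finset.mem_erase]
    constructor
    · rintro ⟨e, ⟨he, hve⟩, rfl⟩
      obtain ⟨w, hw⟩ := Sym2.mem_iff_exists.1 hve
      refine ⟨w, ⟨?_, he w (by simp [hw])⟩, hw.symm⟩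
      rintro rfl
      have := e.2
      rw [hw, mem_edgeSet] at this
      exact this.ne rfl
    · rintro ⟨w, ⟨hwv, hw⟩, rfl⟩
      refine ⟨⟨s(v, w), hW hv hw hwv.symm⟩, ⟨fun x hx => ?_, Sym2.mem_mk_left v w⟩, rfl⟩
      rcases Sym2.mem_iff.1 hx with rfl | rfl <;> assumption
  rw [← Finset.card_image_of_injective _ Subtype.val_injective, himage,
    Finset.card_image_of_injective, Finset.card_erase_of_mem hv]
  intro x y hxy
  exact Sym2.congr_right.1 hxy

theorem image_fst_choosePaths (W : Finset V) (L : Finset G.edgeSet) :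
    (choosePaths W L).image Prod.fst = edgesIn G W := by
  ext e
  simp only [Finset.mem_image, mem_choosePaths]
  exact ⟨by rintro ⟨p, hp, rfl⟩; exact hp.1, fun he => ⟨(e, decide (e ∈ L)), by simp [he]⟩⟩

theorem injOn_fst_choosePaths (W : Finset V) (L : Finset G.edgeSet) :
    Set.InjOn Prod.fst (choosePaths W L : Set (G.edgeSet × Bool)) := by
  rintro ⟨e, b⟩ hp ⟨e', b'⟩ hq (rfl : e = e')
  have h1 := (mem_choosePaths.1 hp).2
  have h2 := (mem_choosePaths.1 hq).2
  exact Prod.ext rfl (Bool.eq_iff_iff.2 (h1.trans h2.symm))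

theorem card_choosePaths (W : Finset V) (L : Finset G.edgeSet) :
    (choosePaths W L).card = (edgesIn G W).card := by
  rw [← image_fst_choosePaths W L, Finset.card_image_of_injOn (injOn_fst_choosePaths W L)]

theorem card_filter_mem_choosePaths (W : Finset V) (L : Finset G.edgeSet) (v : V) :
    ((choosePaths W L).filter (v ∈ ·.1.1)).card = ((edgesIn G W).filter (v ∈ ·.1)).card := by
  rw [← image_fst_choosePaths W L, Finset.filter_image, Finset.card_image_of_injOn]
  exact (injOn_fst_choosePaths W L).mono (Finset.coe_subset.2 (Finset.filter_subset _ _))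

theorem card_filter_snd_choosePaths {W : Finset V} {L : Finset G.edgeSet}
    (hL : L ⊆ edgesIn G W) : ((choosePaths W L).filter (·.2 = true)).card = L.card := by
  have himage : ((choosePaths W L).filter (·.2 = true)).image Prod.fst = L := by
    ext e
    simp only [Finset.mem_image, Finset.mem_filter, mem_choosePaths]
    constructor
    · rintro ⟨p, ⟨⟨-, hp⟩, hb⟩, rfl⟩
      exact hp.1 hb
    · exact fun he => ⟨(e, true), by simp [he, hL he]⟩
  conv_rhs => rw [← himage]
  rw [Finset.card_image_of_injOn]
  exact (injOn_fst_choosePaths W L).mono (Finset.coe_subset.2 (Finset.filter_subset _ _))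

/-- The only two-regular unions of three paths on three branch vertices are those in which
the edges of a triangle are replaced by one path each. -/
theorem isClique_and_eq_choosePaths {W : Finset V} {F : Finset (G.edgeSet × Bool)}
    (hWF : ∀ p ∈ F, ∀ v ∈ p.1.1, v ∈ W)
    (hdeg : ∀ v ∈ W, (F.filter (v ∈ ·.1.1)).card = 2) (hW : W.card = 3) (hF : F.card = 3) :
    G.IsClique W ∧ ∃ L ⊆ edgesIn G W, F = choosePaths W L := by
  have hpar : ∀ e, (e, true) ∈ F → (e, false) ∉ F := by
    intro e ht hf
    have hlt : ({source e, target e} : Finset V).card < W.card := by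
      rw [Finset.card_pair (source_ne_target e)]
      omega
    obtain ⟨w, hw, hwe⟩ := Finset.exists_mem_notMem_of_card_lt_card hlt
    have hsub : F.filter (w ∈ ·.1.1) ⊆ (F.erase (e, true)).erase (e, false) := by
      intro p hp
      obtain ⟨hpF, hwp⟩ := Finset.mem_filter.1 hp
      have hne : p.1 ≠ e := by
        rintro rfl
        rw [mem_edge_iff] at hwp
        simp only [Finset.mem_insert, Finset.mem_singleton] at hwe
        exact hwe hwp
      simp only [Finset.mem_erase]
      exact ⟨fun h => hne (h ▸ rfl), fun h => hne (h ▸ rfl), hpF⟩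
    have hle := Finset.card_le_card hsub
    rw [hdeg w hw, Finset.card_erase_of_mem (by simp [hf]), Finset.card_erase_of_mem ht] at hle
    omega
  have hinj : Set.InjOn Prod.fst (F : Set (G.edgeSet × Bool)) := by
    rintro ⟨e, b⟩ hp ⟨e', b'⟩ hq (rfl : e = e')
    rw [Finset.mem_coe] at hp hq
    cases b <;> cases b' <;> first | rfl | exact (hpar e ‹_› ‹_›).elim
  have hsub : F.image Prod.fst ⊆ edgesIn G W := by
    intro e he
    obtain ⟨p, hp, rfl⟩ := Finset.mem_image.1 he
    exact mem_edgesIn.2 (hWF p hp)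
  have hcard : (F.image Prod.fst).card = 3 := by rw [Finset.card_image_of_injOn hinj, hF]
  have hle : (edgesIn G W).card ≤ 3 := by simpa [hW] using card_edgesIn_le (G := G) W
  have himage : F.image Prod.fst = edgesIn G W :=
    Finset.eq_of_subset_of_card_le hsub (by omega)
  refine ⟨isClique_of_card_edgesIn ?_, ({e | (e, true) ∈ F} : Finset G.edgeSet), ?_, ?_⟩
  · rw [← himage, hcard, hW]
    decide
  · intro e he
    exact hsub (Finset.mem_image.2 ⟨(e, true), by simpa using he, rfl⟩)
  · ext ⟨e, b⟩
    rw [mem_choosePaths, ← himage]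
    simp only [Finset.mem_filter, Finset.mem_univ, true_and]
    constructor
    · intro h
      refine ⟨Finset.mem_image.2 ⟨_, h, rfl⟩, ?_⟩
      cases b
      · simpa using fun h' => hpar e h' h
      · simpa using h
    · rintro ⟨he, hb⟩
      obtain ⟨⟨e', b'⟩, hp, rfl⟩ := Finset.mem_image.1 he
      cases b <;> cases b' <;> simp_all

theorem card_eq_three_of_mul_add {m q i : ℕ} (hℓ : 2 ≤ ℓ) (hi : i = 1 ∨ i = 2) (hq : q ≤ m)
    (h : m * ℓ + q = 3 * ℓ + i) (h8 : 3 * ℓ + i ≠ 8) : m = 3 ∧ q = i := by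
  have hm : m = 3 := by
    by_contra hm
    rcases Nat.lt_or_gt_of_ne hm with hm | hm
    · interval_cases m <;> omega
    · have := Nat.mul_le_mul_right ℓ (show 4 ≤ m from hm)
      omega
  subst hm
  omega

theorem exists_eq_choosePaths_of_iso {i : ℕ} (hℓ : 2 ≤ ℓ) (hi : i = 1 ∨ i = 2)
    (h8 : 3 * ℓ + i ≠ 8) {S : (G.doublePathSubdivision ℓ).Subgraph}
    (φ : S.coe ≃g cycleGraph (3 * ℓ + i)) :
    ∃ W ∈ G.cliqueFinset 3, ∃ L ∈ (edgesIn G W).powersetCard i,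
      unionSubgraph ℓ W (choosePaths W L) = S := by
  have hdegS : ∀ x ∈ S.verts, (S.neighborSet x).ncard = 2 := fun x hx =>
    Subgraph.ncard_neighborSet_of_iso_cycleGraph (by omega) φ hx
  have hcard := Subgraph.ncard_verts_of_iso_cycleGraph φ
  obtain ⟨W, F, hWF, rfl⟩ := exists_eq_unionSubgraph hℓ hdegS
  have hdeg : ∀ v ∈ W, (F.filter (v ∈ ·.1.1)).card = 2 := fun v hv =>
    card_filter_mem_of_forall_ncard hℓ hdegS hv
  have hWcard := card_eq_of_forall_card_filter_mem hWF hdeg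
  have hsum := sum_pathLength hℓ F
  change (unionVerts W F).ncard = _ at hcard
  rw [ncard_unionVerts] at hcard
  obtain ⟨hF3, hq⟩ := card_eq_three_of_mul_add hℓ hi (Finset.card_filter_le F (·.2 = true))
    (by omega) h8
  obtain ⟨hclique, L, hL, rfl⟩ := isClique_and_eq_choosePaths hWF hdeg (hWcard.trans hF3) hF3
  rw [card_filter_snd_choosePaths hL] at hq
  exact ⟨W, mem_cliqueFinset_iff.2 ⟨hclique, hWcard.trans hF3⟩, L,
    Finset.mem_powersetCard.2 ⟨hL, hq⟩, rfl⟩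

theorem nonempty_iso_unionSubgraph_choosePaths (hℓ : 2 ≤ ℓ) {W : Finset V}
    (hW : G.IsNClique 3 W) {L : Finset G.edgeSet} (hL : L ⊆ edgesIn G W) :
    Nonempty ((unionSubgraph ℓ W (choosePaths W L)).coe ≃g cycleGraph (3 * ℓ + L.card)) := by
  have hWF : ∀ p ∈ choosePaths W L, ∀ v ∈ p.1.1, v ∈ W := fun p hp =>
    mem_edgesIn.1 (mem_choosePaths.1 hp).1
  have hedges : (edgesIn G W).card = 3 := by
    rw [card_edgesIn hW.isClique, hW.card_eq]
    decide
  obtain ⟨a, ha⟩ : W.Nonempty := Finset.card_pos.1 (by rw [hW.card_eq]; omega)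
  refine Subgraph.nonempty_iso_cycleGraph_of_connected
    (unionSubgraph_connected hℓ hWF ha ?_) ?_ ?_
  · intro v hv hva
    let e : G.edgeSet := ⟨s(a, v), hW.isClique ha hv hva.symm⟩
    refine ⟨(e, decide (e ∈ L)), mem_choosePaths.2 ⟨mem_edgesIn.2 fun x hx => ?_, by simp⟩, rfl⟩
    rcases Sym2.mem_iff.1 hx with rfl | rfl <;> assumption
  · change (unionVerts W (choosePaths W L)).ncard = _
    have hsum := sum_pathLength hℓ (choosePaths W L)
    rw [card_filter_snd_choosePaths hL, card_choosePaths, hedges] at hsum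
    rw [ncard_unionVerts, hW.card_eq]
    omega
  · rintro x (⟨v, hv, rfl⟩ | ⟨p, hp, t, ht, htb, rfl⟩)
    · rw [ncard_neighborSet_unionSubgraph_inl hℓ hv, card_filter_mem_choosePaths,
        card_filter_mem_edgesIn hW.isClique hv, hW.card_eq]
    · exact ncard_neighborSet_unionSubgraph_pathVertex hℓ hWF hp ht htb

theorem ncard_subgraph_iso_cycleGraph {i : ℕ} (hℓ : 2 ≤ ℓ) (hi : i = 1 ∨ i = 2)
    (h8 : 3 * ℓ + i ≠ 8) :
    {S : (G.doublePathSubdivision ℓ).Subgraph |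
      Nonempty (S.coe ≃g cycleGraph (3 * ℓ + i))}.ncard = 3 * (G.cliqueFinset 3).card := by
  let pairs : Finset (Σ _ : Finset V, Finset G.edgeSet) :=
    (G.cliqueFinset 3).sigma fun W => (edgesIn G W).powersetCard i
  have himage : {S : (G.doublePathSubdivision ℓ).Subgraph |
      Nonempty (S.coe ≃g cycleGraph (3 * ℓ + i))} =
      (fun p : Σ _ : Finset V, Finset G.edgeSet =>
        unionSubgraph ℓ p.1 (choosePaths p.1 p.2)) '' pairs := by
    ext S
    constructor
    · rintro ⟨φ⟩
      obtain ⟨W, hW, L, hL, rfl⟩ := exists_eq_choosePaths_of_iso hℓ hi h8 φ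
      exact ⟨⟨W, L⟩, Finset.mem_coe.2 (Finset.mem_sigma.2 ⟨hW, hL⟩), rfl⟩
    · rintro ⟨⟨W, L⟩, hp, rfl⟩
      obtain ⟨hW, hL⟩ := Finset.mem_sigma.1 (Finset.mem_coe.1 hp)
      obtain ⟨hsub, rfl⟩ := Finset.mem_powersetCard.1 hL
      exact nonempty_iso_unionSubgraph_choosePaths hℓ (mem_cliqueFinset_iff.1 hW) hsub
  have hinj : Set.InjOn (fun p : Σ _ : Finset V, Finset G.edgeSet =>
      unionSubgraph ℓ p.1 (choosePaths p.1 p.2)) pairs := by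
    rintro ⟨W, L⟩ hp ⟨W', L'⟩ hp' h
    obtain ⟨rfl, hF⟩ := unionSubgraph_inj hℓ h
    have hL := (Finset.mem_powersetCard.1 (Finset.mem_sigma.1 (Finset.mem_coe.1 hp)).2).1
    have hL' := (Finset.mem_powersetCard.1 (Finset.mem_sigma.1 (Finset.mem_coe.1 hp')).2).1
    have hLL : L = L' := by
      ext e
      have hmem : (e, true) ∈ choosePaths W L ↔ (e, true) ∈ choosePaths W L' :=
        Finset.ext_iff.1 hF _
      simp only [mem_choosePaths, true_iff] at hmem
      exact ⟨fun he => (hmem.1 ⟨hL he, he⟩).2, fun he => (hmem.2 ⟨hL' he, he⟩).2⟩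
    rw [hLL]
  rw [himage, hinj.ncard_image, Set.ncard_coe_finset, Finset.card_sigma,
    Finset.sum_const_nat (m := 3), mul_comm]
  intro W hW
  have hW := mem_cliqueFinset_iff.1 hW
  rw [Finset.card_powersetCard, card_edgesIn hW.isClique, hW.card_eq]
  rcases hi with rfl | rfl <;> decide

theorem ncard_subgraph_iso_cycleGraph_three :
    {S : G.Subgraph | Nonempty (S.coe ≃g cycleGraph 3)}.ncard = (G.cliqueFinset 3).card := by
  have himage : {S : G.Subgraph | Nonempty (S.coe ≃g cycleGraph 3)} =
      (fun W : Finset V => (⊤ : G.Subgraph).induce W) '' (G.cliqueFinset 3 : Set _) := by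
    ext S
    rw [Set.mem_ofPred_eq, cycleGraph_three_eq_top]
    constructor
    · rintro ⟨φ⟩
      have hadj : ∀ x ∈ S.verts, ∀ y ∈ S.verts, x ≠ y → S.Adj x y := by
        intro x hx y hy hxy
        have : S.coe.Adj ⟨x, hx⟩ ⟨y, hy⟩ := φ.map_adj_iff.1 (by simpa using hxy)
        exact this
      refine ⟨S.verts.toFinset, Finset.mem_coe.2 (mem_cliqueFinset_iff.2 ⟨?_, ?_⟩), ?_⟩
      · intro x hx y hy hxy
        exact (hadj x (by simpa using hx) y (by simpa using hy) hxy).adj_sub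
      · rw [← Set.ncard_eq_toFinset_card']
        exact (Nat.card_congr φ.toEquiv).trans (Nat.card_fin 3)
      · refine Subgraph.ext (by simp) ?_
        ext x y
        simp only [Set.coe_toFinset, Subgraph.induce_adj, Subgraph.top_adj]
        exact ⟨fun h => hadj x h.1 y h.2.1 h.2.2.ne,
          fun h => ⟨h.fst_mem, h.snd_mem, h.adj_sub⟩⟩
    · rintro ⟨W, hW, rfl⟩
      have hW := mem_cliqueFinset_iff.1 (Finset.mem_coe.1 hW)
      let φ : ((⊤ : G.Subgraph).induce W).verts ≃ Fin 3 := Finset.equivFinOfCardEq hW.card_eq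
      refine ⟨⟨φ, ?_⟩⟩
      rintro ⟨x, hx⟩ ⟨y, hy⟩
      change φ ⟨x, hx⟩ ≠ φ ⟨y, hy⟩ ↔ ((⊤ : G.Subgraph).induce W).Adj x y
      rw [φ.injective.ne_iff, Subgraph.induce_adj, Subgraph.top_adj, Ne, Subtype.mk.injEq]
      exact ⟨fun h => ⟨hx, hy, hW.isClique hx hy h⟩, fun h => h.2.2.ne⟩
  rw [himage, Set.ncard_image_of_injective, Set.ncard_coe_finset]
  intro W W' h
  simpa using congrArg Subgraph.verts h

end Counting

end DoublePath

end SimpleGraph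

/-- Let `k = 3ℓ + i` with `ℓ ≥ 2`, `i ∈ {1, 2}` and `k ≠ 8`. The number of
subgraphs isomorphic to the cycle `C_k` in the graph obtained from a finite simple
graph `G` by replacing every edge by two internally disjoint paths of lengths `ℓ`
and `ℓ + 1` equals 3 times the number of triangles of `G`. -/
theorem count_cycles_doublePathSubdivision {V : Type*} [Fintype V]
    (G : SimpleGraph V) (ℓ i k : ℕ) (hℓ : 2 ≤ ℓ) (hi : i = 1 ∨ i = 2)
    (hk : k = 3 * ℓ + i) (hk8 : k ≠ 8) :
    {S : (G.doublePathSubdivision ℓ).Subgraph |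
        Nonempty (S.coe ≃g SimpleGraph.cycleGraph k)}.ncard
      = 3 * {S : G.Subgraph | Nonempty (S.coe ≃g SimpleGraph.cycleGraph 3)}.ncard := by
  subst hk
  rw [SimpleGraph.DoublePath.ncard_subgraph_iso_cycleGraph hℓ hi hk8,
    SimpleGraph.DoublePath.ncard_subgraph_iso_cycleGraph_three]
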